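/- Let (α > 0, 1 ≤ p ≤ ∞, 0 < q < ∞), and let E_ω ⊆ L^p be an increasing family of finite-dimensional subspaces indexed by ω > 0. Define 𝓔(F, ω, p) = inf_{G ∈ E_ω} ‖F − G‖_p. Suppose there are bounded operators β_ν (ν ≥ −1) on L^p with norms uniformly bounded, such that: (i) β_ν G = 0 whenever ν ≥ 1 and G ∈ E_{2^{2ν−2}}; (ii) F = ∑_ν β_ν² F whenever the right side converges, with F − ∑_{ν > j} β_ν² F ∈ E_{2^{2j+4}}. Then the quantity ‖F‖_p + (∑_{j≥0} (2^{αj} 𝓔(F, 2^{2j}, p))^q)^{1/q} is finite if and only if (∑_ν (2^{να} ‖β_ν F‖_p)^q)^{1/q} is finite, and the two quasi-norms ‖F‖_p + (∑_j (2^{αj}𝓔(F,2^{2j},p))^q)^{1/q} and ‖F‖_p + (∑_ν (2^{να}‖β_ν F‖_p)^q)^{1/q} are equivalent. -/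

import Mathlib

open scoped ENNReal

/-- A discrete Hardy inequality, valid for every exponent `q > 0`. -/
theorem tsum_geometric_tail_rpow_le (r : ℝ≥0∞) {q : ℝ} (hq : 0 < q) (a : ℕ → ℝ≥0∞) :
    ∑' j, (∑' k, (r * r) ^ k * a (j + k)) ^ q ≤
      (∑' k, r ^ k) ^ q * (∑' k, (r ^ q) ^ k) * ∑' j, a j ^ q := by
  have pointwise : ∀ j, (∑' k, (r * r) ^ k * a (j + k)) ^ q ≤
      (∑' k, r ^ k) ^ q * ∑' k, (r ^ q) ^ k * a (j + k) ^ q := by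
    intro j
    set S := ∑' k, (r ^ q) ^ k * a (j + k) ^ q with hS
    have hterm : ∀ k, r ^ k * a (j + k) ≤ S ^ (1 / q) := by
      intro k
      rw [one_div, ENNReal.le_rpow_inv_iff hq, ENNReal.mul_rpow_of_nonneg _ _ hq.le]
      refine le_trans (le_of_eq ?_) (ENNReal.le_tsum k)
      rw [← ENNReal.rpow_natCast, ← ENNReal.rpow_natCast, ← ENNReal.rpow_mul,
        ← ENNReal.rpow_mul, mul_comm q]
    have hsum : ∑' k, (r * r) ^ k * a (j + k) ≤ (∑' k, r ^ k) * S ^ (1 / q) := by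
      rw [← ENNReal.tsum_mul_right]
      refine ENNReal.tsum_le_tsum fun k => ?_
      rw [mul_pow, mul_assoc]
      exact mul_le_mul_right (hterm k) _
    refine (ENNReal.rpow_le_rpow hsum hq.le).trans (le_of_eq ?_)
    rw [ENNReal.mul_rpow_of_nonneg _ _ hq.le, ← ENNReal.rpow_mul, one_div,
      inv_mul_cancel₀ hq.ne', ENNReal.rpow_one]
  refine (ENNReal.tsum_le_tsum pointwise).trans ?_
  rw [ENNReal.tsum_mul_left, ENNReal.tsum_comm, mul_assoc]
  refine mul_le_mul_right ?_ _
  rw [← ENNReal.tsum_mul_right]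
  refine ENNReal.tsum_le_tsum fun k => ?_
  rw [ENNReal.tsum_mul_left]
  exact mul_le_mul_right
    (ENNReal.tsum_comp_le_tsum_of_injective (add_left_injective k) fun i => a i ^ q) _

theorem tsum_pow_ne_top {r : ℝ≥0∞} (hr : r < 1) : ∑' k : ℕ, r ^ k ≠ ⊤ := by
  rw [ENNReal.tsum_geometric]
  exact ENNReal.inv_ne_top.2 (tsub_pos_of_lt hr).ne'

/-- A bound on `q`-th powers gives a bound on the corresponding quasi-norms. -/
theorem add_rpow_one_div_le {q : ℝ} (hq : 0 < q) {f T L M K : ℝ≥0∞}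
    (h : T ≤ M * f ^ q + K * L) :
    f + T ^ (1 / q) ≤ (1 + (M + K) ^ (1 / q)) * (f + L ^ (1 / q)) := by
  have hT : T ≤ (M + K) * (f + L ^ (1 / q)) ^ q := by
    refine h.trans ?_
    rw [add_mul]
    refine add_le_add (mul_le_mul_right (ENNReal.rpow_le_rpow le_self_add hq.le) _)
      (mul_le_mul_right ?_ _)
    rw [← ENNReal.rpow_inv_le_iff hq, ← one_div]
    exact le_add_self
  rw [add_mul, one_mul]
  refine add_le_add le_self_add ?_
  rw [one_div, ENNReal.rpow_inv_le_iff hq, ENNReal.mul_rpow_of_nonneg _ _ hq.le,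
    ENNReal.rpow_inv_rpow hq.ne', ← one_div]
  exact hT

/-- Shifting identifies the integers above `m` with the natural numbers. -/
def natEquivIntGE (m : ℤ) : ℕ ≃ {ν : ℤ // m ≤ ν} where
  toFun n := ⟨m + n, by omega⟩
  invFun ν := (ν.1 - m).toNat
  left_inv n := by simp
  right_inv ν := by
    have := ν.2
    ext
    simp only
    omega

theorem enorm_tsum_int_gt_le {V : Type*} [NormedAddCommGroup V] (g : ℤ → V) (m : ℤ) :
    ‖∑' ν : {ν : ℤ // m < ν}, g ν.1‖ₑ ≤ ∑' k : ℕ, ‖g (m + 1 + k)‖ₑ := by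
  have h : ∑' ν : {ν : ℤ // m < ν}, g ν.1 = ∑' k : ℕ, g (m + 1 + k) :=
    ((natEquivIntGE (m + 1)).tsum_eq fun ν : {ν : ℤ // m + 1 ≤ ν} => g ν.1).symm
  rw [h]
  exact enorm_tsum_le_tsum_enorm

theorem tsum_int_ge_neg_one (a : ℤ → ℝ≥0∞) :
    ∑' ν : {ν : ℤ // -1 ≤ ν}, a ν.1 = a (-1) + a 0 + ∑' n : ℕ, a (n + 1) := by
  rw [← (natEquivIntGE (-1)).tsum_eq fun ν : {ν : ℤ // -1 ≤ ν} => a ν.1,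
    tsum_eq_zero_add' ENNReal.summable, tsum_eq_zero_add' ENNReal.summable, ← add_assoc]
  congr 1
  refine tsum_congr fun n => ?_
  congr 1
  simp only [natEquivIntGE, Equiv.coe_fn_mk]
  push_cast
  ring

/-- The distance from `F` to the subspace `W`. -/
noncomputable abbrev bestApprox {V : Type*} [NormedAddCommGroup V] [NormedSpace ℂ V]
    (W : Submodule ℂ V) (F : V) : ℝ :=
  sInf ((fun G => ‖F - G‖) '' (W : Set V))

section bestApprox

variable {V : Type*} [NormedAddCommGroup V] [NormedSpace ℂ V] {W : Submodule ℂ V} {F : V}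

theorem bestApprox_le {G : V} (hG : G ∈ W) : bestApprox W F ≤ ‖F - G‖ :=
  csInf_le ⟨0, by rintro _ ⟨H, -, rfl⟩; exact norm_nonneg _⟩ ⟨G, hG, rfl⟩

theorem bestApprox_le_norm : bestApprox W F ≤ ‖F‖ := by
  simpa using bestApprox_le (F := F) W.zero_mem

theorem norm_apply_le_mul_bestApprox {T : V →L[ℂ] V} {c : ℝ} (hc : 0 < c) (hT : ‖T‖ ≤ c)
    (hW : ∀ G ∈ W, T G = 0) : ‖T F‖ ≤ c * bestApprox W F := by
  rw [← div_le_iff₀' hc]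
  refine le_csInf ⟨_, 0, W.zero_mem, rfl⟩ ?_
  rintro _ ⟨G, hG, rfl⟩
  rw [div_le_iff₀' hc]
  calc ‖T F‖ = ‖T (F - G)‖ := by rw [map_sub, hW G hG, sub_zero]
    _ ≤ c * ‖F - G‖ := T.le_of_opNorm_le hT _

end bestApprox

/-- Equivalence of the best-approximation Besov quasi-norm and the
Littlewood–Paley quasi-norm: with `𝓔(F,ω) = inf_{G ∈ E_ω} ‖F − G‖`, uniformly
bounded operators `β_ν` (`ν ≥ −1`) killing `E_{2^{2ν−2}}` for `ν ≥ 1`, and the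
reproducing property `F = ∑_ν β_ν² F` with tails
`F − ∑_{ν>j} β_ν² F ∈ E_{2^{2j+4}}`, the quasi-norms
`‖F‖ + (∑_j (2^{αj}𝓔(F,2^{2j}))^q)^{1/q}` and
`‖F‖ + (∑_ν (2^{να}‖β_ν F‖)^q)^{1/q}` are equivalent (in particular one is
finite iff the other is). -/
theorem stmt19 {V : Type*} [NormedAddCommGroup V] [NormedSpace ℂ V]
    (α : ℝ) (hα : 0 < α) (q : ℝ) (hq : 0 < q)
    (E : ℝ → Submodule ℂ V)
    (hEmono : ∀ ω ω' : ℝ, ω ≤ ω' → E ω ≤ E ω')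
    (hEfd : ∀ ω : ℝ, FiniteDimensional ℂ (E ω))
    (β : ℤ → V →L[ℂ] V) (Cβ : ℝ)
    (hβb : ∀ ν : ℤ, -1 ≤ ν → ‖β ν‖ ≤ Cβ)
    (hker : ∀ ν : ℤ, 1 ≤ ν → ∀ G ∈ E ((2 : ℝ) ^ (2 * ν - 2)), β ν G = 0)
    (hrecon : ∀ F : V,
      Summable (fun ν : {ν : ℤ // -1 ≤ ν} => β ν.1 (β ν.1 F)) →
      HasSum (fun ν : {ν : ℤ // -1 ≤ ν} => β ν.1 (β ν.1 F)) F)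
    (htail : ∀ (F : V) (j : ℕ),
      Summable (fun ν : {ν : ℤ // -1 ≤ ν} => β ν.1 (β ν.1 F)) →
      F - ∑' ν : {ν : ℤ // (j : ℤ) < ν}, β ν.1 (β ν.1 F) ∈ E ((2 : ℝ) ^ (2 * (j : ℤ) + 4)))
    (hsum : ∀ F : V,
      (∑' ν : {ν : ℤ // -1 ≤ ν},
        (ENNReal.ofReal ((2 : ℝ) ^ (α * (ν.1 : ℝ)) * ‖β ν.1 F‖)) ^ q) ≠ ⊤ →
      Summable (fun ν : {ν : ℤ // -1 ≤ ν} => β ν.1 (β ν.1 F))) :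
    ∃ C : ℝ≥0∞, C ≠ ⊤ ∧ 0 < C ∧ ∀ F : V,
      (ENNReal.ofReal ‖F‖ +
          (∑' j : ℕ, (ENNReal.ofReal ((2 : ℝ) ^ (α * (j : ℝ)) *
            sInf ((fun G => ‖F - G‖) '' (E ((2 : ℝ) ^ (2 * (j : ℝ))) : Set V)))) ^ q)
            ^ (1 / q) ≤
        C * (ENNReal.ofReal ‖F‖ +
          (∑' ν : {ν : ℤ // -1 ≤ ν},
            (ENNReal.ofReal ((2 : ℝ) ^ (α * (ν.1 : ℝ)) * ‖β ν.1 F‖)) ^ q) ^ (1 / q))) ∧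
      (ENNReal.ofReal ‖F‖ +
          (∑' ν : {ν : ℤ // -1 ≤ ν},
            (ENNReal.ofReal ((2 : ℝ) ^ (α * (ν.1 : ℝ)) * ‖β ν.1 F‖)) ^ q) ^ (1 / q) ≤
        C * (ENNReal.ofReal ‖F‖ +
          (∑' j : ℕ, (ENNReal.ofReal ((2 : ℝ) ^ (α * (j : ℝ)) *
            sInf ((fun G => ‖F - G‖) '' (E ((2 : ℝ) ^ (2 * (j : ℝ))) : Set V)))) ^ q)
            ^ (1 / q))) := by
  set c : ℝ := max Cβ 1 with hc
  have hc0 : 0 < c := lt_max_of_lt_right one_pos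
  have hβc : ∀ ν : ℤ, -1 ≤ ν → ‖β ν‖ ≤ c := fun ν hν => (hβb ν hν).trans (le_max_left _ _)
  set w : ℝ → ℝ≥0∞ := fun s => ENNReal.ofReal ((2 : ℝ) ^ (α * s)) with hw
  have hw_top : ∀ s, w s ≠ ⊤ := fun s => ENNReal.ofReal_ne_top
  have hw_add : ∀ s t, w (s + t) = w s * w t := by
    intro s t
    rw [hw]
    simp only
    rw [mul_add, Real.rpow_add two_pos, ENNReal.ofReal_mul (by positivity)]
  have hw_mul : ∀ (s x : ℝ), ENNReal.ofReal ((2 : ℝ) ^ (α * s) * x) = w s * ENNReal.ofReal x :=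
    fun s x => ENNReal.ofReal_mul (by positivity)
  set C := ENNReal.ofReal c with hC
  set r : ℝ≥0∞ := w (-(1 / 2)) with hr
  have hr1 : r < 1 := by
    rw [hr, hw, ← ENNReal.ofReal_one]
    refine (ENNReal.ofReal_lt_ofReal_iff one_pos).2 ?_
    exact Real.rpow_lt_one_of_one_lt_of_neg one_lt_two (by linarith)
  have hw_pow : ∀ k : ℕ, w (-k) = (r * r) ^ k := by
    intro k
    induction k with
    | zero => simp [hw]
    | succ k ih =>
      rw [pow_succ, ← ih, hr, ← hw_add, ← hw_add]
      congr 1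
      push_cast
      ring
  set H : ℝ≥0∞ := (∑' k : ℕ, r ^ k) ^ q * ∑' k : ℕ, (r ^ q) ^ k with hH
  have hH_top : H ≠ ⊤ := ENNReal.mul_ne_top
    (ENNReal.rpow_ne_top_of_nonneg hq.le (tsum_pow_ne_top hr1))
    (tsum_pow_ne_top (ENNReal.rpow_lt_one hr1 hq))
  set M₁ : ℝ≥0∞ := w 0 ^ q + w 1 ^ q with hM₁
  set K₁ : ℝ≥0∞ := 1 + (w 1 * C) ^ q * H with hK₁
  set M₂ : ℝ≥0∞ := (w (-1) * C) ^ q + (w 0 * C) ^ q with hM₂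
  set K₂ : ℝ≥0∞ := (w 1 * C) ^ q with hK₂
  have hrpow : ∀ {x : ℝ≥0∞}, x ≠ ⊤ → x ^ q ≠ ⊤ := ENNReal.rpow_ne_top_of_nonneg hq.le
  have hwC : ∀ s, (w s * C) ^ q ≠ ⊤ := fun s =>
    hrpow (ENNReal.mul_ne_top (hw_top s) ENNReal.ofReal_ne_top)
  have hq' : 0 ≤ 1 / q := by positivity
  set C₁ : ℝ≥0∞ := 1 + (M₁ + K₁) ^ (1 / q) with hC₁
  set C₂ : ℝ≥0∞ := 1 + (M₂ + K₂) ^ (1 / q) with hC₂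
  have hC₁_top : C₁ ≠ ⊤ := ENNReal.add_ne_top.2 ⟨ENNReal.one_ne_top,
    ENNReal.rpow_ne_top_of_nonneg hq' (ENNReal.add_ne_top.2
      ⟨ENNReal.add_ne_top.2 ⟨hrpow (hw_top 0), hrpow (hw_top 1)⟩,
        ENNReal.add_ne_top.2 ⟨ENNReal.one_ne_top, ENNReal.mul_ne_top (hwC 1) hH_top⟩⟩)⟩
  have hC₂_top : C₂ ≠ ⊤ := ENNReal.add_ne_top.2 ⟨ENNReal.one_ne_top,
    ENNReal.rpow_ne_top_of_nonneg hq' (ENNReal.add_ne_top.2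
      ⟨ENNReal.add_ne_top.2 ⟨hwC (-1), hwC 0⟩, hwC 1⟩)⟩
  refine ⟨C₁ + C₂, ENNReal.add_ne_top.2 ⟨hC₁_top, hC₂_top⟩,
    lt_of_lt_of_le one_pos (le_self_add.trans le_self_add), fun F => ?_⟩
  have hβF : ∀ ν : ℤ, -1 ≤ ν → ∀ x : V, ENNReal.ofReal ‖β ν x‖ ≤ C * ENNReal.ofReal ‖x‖ := by
    intro ν hν x
    rw [← ENNReal.ofReal_mul hc0.le]
    exact ENNReal.ofReal_le_ofReal ((β ν).le_of_opNorm_le (hβc ν hν) x)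
  constructor
  · refine (add_rpow_one_div_le (M := M₁) (K := K₁) hq ?_).trans
      (mul_le_mul_left le_self_add _)
    by_cases hL : (∑' ν : {ν : ℤ // -1 ≤ ν},
        (ENNReal.ofReal ((2 : ℝ) ^ (α * (ν.1 : ℝ)) * ‖β ν.1 F‖)) ^ q) = ⊤
    · rw [hL, ENNReal.mul_top (by simp [hK₁])]
      simp
    have hS := hsum F hL
    rw [tsum_eq_zero_add' ENNReal.summable, tsum_eq_zero_add' ENNReal.summable, ← add_assoc]
    have hlow : ∀ (s : ℝ) (W : Submodule ℂ V),
        ENNReal.ofReal ((2 : ℝ) ^ (α * s) * bestApprox W F) ^ q ≤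
          w s ^ q * ENNReal.ofReal ‖F‖ ^ q := by
      intro s W
      rw [hw_mul, ← ENNReal.mul_rpow_of_nonneg _ _ hq.le]
      exact ENNReal.rpow_le_rpow
        (mul_le_mul_right (ENNReal.ofReal_le_ofReal bestApprox_le_norm) _) hq.le
    refine add_le_add ?_ ?_
    · rw [hM₁, add_mul]
      refine add_le_add ?_ ?_
      · simpa using hlow 0 (E ((2 : ℝ) ^ (2 * ((0 : ℕ) : ℝ))))
      · simpa using hlow 1 (E ((2 : ℝ) ^ (2 * ((0 + 1 : ℕ) : ℝ))))
    · set a : ℕ → ℝ≥0∞ := fun n => w n * ENNReal.ofReal ‖β n F‖ with ha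
      have hhigh : ∀ j : ℕ, ENNReal.ofReal ((2 : ℝ) ^ (α * ((j + 1 + 1 : ℕ) : ℝ)) *
          bestApprox (E ((2 : ℝ) ^ (2 * ((j + 1 + 1 : ℕ) : ℝ)))) F) ≤
          (w 1 * C) * ∑' k : ℕ, (r * r) ^ k * a (j + 1 + k) := by
        intro j
        rw [hw_mul]
        have hmem : F - ∑' ν : {ν : ℤ // (j : ℤ) < ν}, β ν.1 (β ν.1 F) ∈
            E ((2 : ℝ) ^ (2 * ((j + 1 + 1 : ℕ) : ℝ))) := by
          have h := htail F j hS
          rw [← Real.rpow_intCast] at h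
          convert h using 3
          push_cast
          ring
        have h1 := ENNReal.ofReal_le_ofReal (bestApprox_le (F := F) hmem)
        rw [sub_sub_cancel, ofReal_norm] at h1
        have h2 := h1.trans (enorm_tsum_int_gt_le (fun ν => β ν (β ν F)) j)
        refine (mul_le_mul_right h2 _).trans ?_
        rw [← ENNReal.tsum_mul_left, ← ENNReal.tsum_mul_left]
        refine ENNReal.tsum_le_tsum fun k => ?_
        have hs : w ((j + 1 + 1 : ℕ) : ℝ) = w 1 * (r * r) ^ k * w ((j + 1 + k : ℕ) : ℝ) := by
          rw [← hw_pow, ← hw_add, ← hw_add]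
          congr 1
          push_cast
          ring
        have h3 := hβF (j + 1 + k) (by omega) (β (j + 1 + k) F)
        rw [hs, ← ofReal_norm]
        refine (mul_le_mul_right h3 _).trans (le_of_eq ?_)
        rw [ha]
        push_cast
        ring
      calc _ ≤ ∑' j : ℕ, ((w 1 * C) * ∑' k : ℕ, (r * r) ^ k * a (j + 1 + k)) ^ q :=
            ENNReal.tsum_le_tsum fun j => ENNReal.rpow_le_rpow (hhigh j) hq.le
        _ = (w 1 * C) ^ q * ∑' j : ℕ, (∑' k : ℕ, (r * r) ^ k * a (j + 1 + k)) ^ q := by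
            rw [← ENNReal.tsum_mul_left]
            exact tsum_congr fun j => ENNReal.mul_rpow_of_nonneg _ _ hq.le
        _ ≤ (w 1 * C) ^ q * ∑' j : ℕ, (∑' k : ℕ, (r * r) ^ k * a (j + k)) ^ q :=
            mul_le_mul_right (ENNReal.tsum_comp_le_tsum_of_injective (add_left_injective 1)
              fun j => (∑' k : ℕ, (r * r) ^ k * a (j + k)) ^ q) _
        _ ≤ (w 1 * C) ^ q * (H * ∑' j, a j ^ q) :=
            mul_le_mul_right (tsum_geometric_tail_rpow_le r hq a) _
        _ ≤ K₁ * ∑' j, a j ^ q := by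
            rw [← mul_assoc]
            exact mul_le_mul_left le_add_self _
        _ ≤ _ := by
            refine mul_le_mul_right ?_ _
            have hinj : Function.Injective
                (fun n : ℕ => (⟨n, by omega⟩ : {ν : ℤ // -1 ≤ ν})) := by
              intro m n h
              simpa using h
            refine le_trans (le_of_eq (tsum_congr fun n => ?_))
              (ENNReal.tsum_comp_le_tsum_of_injective hinj _)
            rw [hw_mul, ha]
            simp
  · refine (add_rpow_one_div_le (M := M₂) (K := K₂) hq ?_).trans
      (mul_le_mul_left le_add_self _)
    rw [tsum_int_ge_neg_one fun ν : ℤ =>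
      (ENNReal.ofReal ((2 : ℝ) ^ (α * (ν : ℝ)) * ‖β ν F‖)) ^ q]
    have hlow : ∀ ν : ℤ, -1 ≤ ν → ENNReal.ofReal ((2 : ℝ) ^ (α * (ν : ℝ)) * ‖β ν F‖) ^ q ≤
        (w ν * C) ^ q * ENNReal.ofReal ‖F‖ ^ q := by
      intro ν hν
      rw [hw_mul, ← ENNReal.mul_rpow_of_nonneg _ _ hq.le, mul_assoc]
      exact ENNReal.rpow_le_rpow (mul_le_mul_right (hβF ν hν F) _) hq.le
    refine add_le_add ?_ ?_
    · rw [hM₂, add_mul]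
      refine add_le_add ?_ ?_
      · simpa using hlow (-1) le_rfl
      · simpa using hlow 0 (by norm_num)
    · rw [← ENNReal.tsum_mul_left]
      refine ENNReal.tsum_le_tsum fun n => ?_
      rw [hK₂, ← ENNReal.mul_rpow_of_nonneg _ _ hq.le]
      refine ENNReal.rpow_le_rpow ?_ hq.le
      have hE : ∀ G ∈ E ((2 : ℝ) ^ (2 * (n : ℝ))), β (n + 1) G = 0 := by
        intro G hG
        refine hker (n + 1) (by omega) G ?_
        rw [← Real.rpow_intCast]
        convert hG using 3
        push_cast
        ring
      have h := ENNReal.ofReal_le_ofReal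
        (norm_apply_le_mul_bestApprox (F := F) hc0 (hβc (n + 1) (by omega)) hE)
      rw [ENNReal.ofReal_mul hc0.le] at h
      rw [hw_mul, hw_mul]
      refine (mul_le_mul_right h _).trans (le_of_eq ?_)
      push_cast
      rw [hw_add]
      ring
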